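/- If a datum (c,d,B) is gaussian-extremizable, then the scaling condition holds and there exist self-adjoint positive-definite operators V_i on E_i (1≤i≤k) and Π ∈ Π(V_1^{−1},…,V_k^{−1}) such that each operator B_j Λ_c Π Λ_c B_j* on E^j is invertible and Σ_{j=1}^m d_j Λ_c B_j* (B_j Λ_c Π Λ_c B_j*)^{−1} B_j Λ_c ≤ ⊕_{i=1}^k c_i V_i as self-adjoint operators on E_0. -/

import Mathlib

open MeasureTheory LinearMap
open scoped RealInnerProductSpace BigOperators NNReal ENNReal

noncomputable section

namespace FRBL

/-- A positive semidefinite (self-adjoint) operator on a real inner product space. -/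
def PosSemidef {G : Type*} [NormedAddCommGroup G] [InnerProductSpace ℝ G]
    (A : G →ₗ[ℝ] G) : Prop :=
  A.IsSymmetric ∧ ∀ x : G, 0 ≤ ⟪A x, x⟫

/-- A positive definite (self-adjoint) operator on a real inner product space. -/
def PosDef {G : Type*} [NormedAddCommGroup G] [InnerProductSpace ℝ G]
    (A : G →ₗ[ℝ] G) : Prop :=
  A.IsSymmetric ∧ ∀ x : G, x ≠ 0 → 0 < ⟪A x, x⟫

variable {k m : ℕ}
  (E : Fin k → Type*) (F : Fin m → Type*)
  [∀ i, NormedAddCommGroup (E i)] [∀ i, InnerProductSpace ℝ (E i)]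
  [∀ i, FiniteDimensional ℝ (E i)]
  [∀ i, MeasurableSpace (E i)] [∀ i, BorelSpace (E i)]
  [∀ j, NormedAddCommGroup (F j)] [∀ j, InnerProductSpace ℝ (F j)]
  [∀ j, FiniteDimensional ℝ (F j)]
  [∀ j, MeasurableSpace (F j)] [∀ j, BorelSpace (F j)]
  (c : Fin k → ℝ) (d : Fin m → ℝ)
  (B : ∀ i j, E i →ₗ[ℝ] F j)

/-- The pointwise domination hypothesis of the forward-reverse Brascamp-Lieb inequality. -/
def Hyp (f : ∀ i, E i → ℝ≥0) (g : ∀ j, F j → ℝ≥0) : Prop :=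
  ∀ x : ∀ i, E i,
    (∏ i, f i (x i) ^ c i) ≤ ∏ j, g j (∑ i, c i • B i j (x i)) ^ d j

/-- `D₀` is an admissible constant for the forward-reverse Brascamp-Lieb inequality. -/
def IsBound (D₀ : ℝ) : Prop :=
  ∀ (f : ∀ i, E i → ℝ≥0) (g : ∀ j, F j → ℝ≥0),
    (∀ i, Measurable (f i)) → (∀ j, Measurable (g j)) →
    Hyp E F c d B f g →
    (∏ i, (∫⁻ x, (f i x : ℝ≥0∞)) ^ c i) ≤
      ENNReal.ofReal (Real.exp D₀) * ∏ j, (∫⁻ y, (g j y : ℝ≥0∞)) ^ d j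

/-- The best constant `D(c,d,B)` in the forward-reverse Brascamp-Lieb inequality. -/
def D : EReal :=
  sInf {x : EReal | ∃ D₀ : ℝ, x = (D₀ : EReal) ∧ IsBound E F c d B D₀}

/-- The gaussian constraint `Λ_c B* U_d B Λ_c ≤ V_c`, written via quadratic forms. -/
def GaussCon (V : ∀ i, E i →ₗ[ℝ] E i) (U : ∀ j, F j →ₗ[ℝ] F j) : Prop :=
  ∀ x : ∀ i, E i,
    (∑ j, d j * ⟪U j (∑ i, c i • B i j (x i)), ∑ i, c i • B i j (x i)⟫) ≤
      ∑ i, c i * ⟪V i (x i), x i⟫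

/-- The objective functional in the definition of the gaussian constant. -/
def gaussObj (V : ∀ i, E i →ₗ[ℝ] E i) (U : ∀ j, F j →ₗ[ℝ] F j) : ℝ :=
  (∑ j, d j * Real.log (LinearMap.det (U j)) -
    ∑ i, c i * Real.log (LinearMap.det (V i))) / 2

/-- The gaussian best constant `D_g(c,d,B)`. -/
def Dg : EReal :=
  sSup {x : EReal | ∃ (V : ∀ i, E i →ₗ[ℝ] E i) (U : ∀ j, F j →ₗ[ℝ] F j),
    (∀ i, PosDef (V i)) ∧ (∀ j, PosDef (U j)) ∧ GaussCon E F c d B V U ∧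
    x = (gaussObj E F c d V U : EReal)}

/-- The datum `(c,d,B)` is gaussian-extremizable: the supremum defining `D_g` is
finite and attained. -/
def GaussExt : Prop :=
  ∃ (V : ∀ i, E i →ₗ[ℝ] E i) (U : ∀ j, F j →ₗ[ℝ] F j),
    (∀ i, PosDef (V i)) ∧ (∀ j, PosDef (U j)) ∧ GaussCon E F c d B V U ∧
    Dg E F c d B = (gaussObj E F c d V U : EReal)

/-- The canonical linear equivalence between `E₀ = ⊕ᵢ Eᵢ` (as `PiLp 2`) and the pi type. -/
def toPi : PiLp 2 E ≃ₗ[ℝ] ∀ i, E i := WithLp.linearEquiv 2 ℝ (∀ i, E i)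

/-- Orthogonal projection `π_{E_i} : E₀ → E_i`. -/
def projL (i : Fin k) : PiLp 2 E →ₗ[ℝ] E i := (LinearMap.proj i).comp (toPi E).toLinearMap

/-- The embedding `E_i → E₀`. -/
def singleL (i : Fin k) : E i →ₗ[ℝ] PiLp 2 E :=
  (toPi E).symm.toLinearMap.comp (LinearMap.single ℝ E i)

/-- The map `B_j : E₀ → E^j`, `x ↦ ∑ᵢ B_{ij} π_{E_i} x`. -/
def Bop (j : Fin m) : PiLp 2 E →ₗ[ℝ] F j := ∑ i, (B i j).comp (projL E i)

/-- `Λ_c = ⊕ᵢ cᵢ id_{E_i}` as an operator on `E₀`. -/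
def Lam : PiLp 2 E →ₗ[ℝ] PiLp 2 E := ∑ i, c i • (singleL E i).comp (projL E i)

/-- The set `Π(A_1, …, A_k)` of positive semidefinite "couplings". -/
def Coupling (A : ∀ i, E i →ₗ[ℝ] E i) : Set (PiLp 2 E →ₗ[ℝ] PiLp 2 E) :=
  {P | PosSemidef P ∧ ∀ (i : Fin k) (v : E i),
    ⟪P (singleL E i v), singleL E i v⟫ = ⟪A i v, v⟫}

/-- The scaling condition `∑ᵢ cᵢ dim Eᵢ = ∑ⱼ dⱼ dim E^j`. -/
def ScalingCond : Prop :=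
  ∑ i, c i * (Module.finrank ℝ (E i) : ℝ) = ∑ j, d j * (Module.finrank ℝ (F j) : ℝ)

/-- A subspace `T ⊆ E₀` is of product form, i.e. `T = ⊕ᵢ π_{E_i} T`. -/
def ProductForm (T : Submodule ℝ (PiLp 2 E)) : Prop :=
  ∀ x ∈ T, ∀ i, singleL E i (projL E i x) ∈ T

/-- The dimension condition over product-form subspaces. -/
def DimCond : Prop :=
  ∀ T : Submodule ℝ (PiLp 2 E), ProductForm E T →
    (∑ i, c i * (Module.finrank ℝ (T.map (projL E i)) : ℝ)) ≤
      ∑ j, d j * (Module.finrank ℝ (T.map (Bop E F B j)) : ℝ)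

/-- A critical subspace. -/
def IsCritical (T : Submodule ℝ (PiLp 2 E)) : Prop :=
  T ≠ ⊥ ∧ T ≠ ⊤ ∧ ProductForm E T ∧
    ∑ i, c i * (Module.finrank ℝ (T.map (projL E i)) : ℝ) =
      ∑ j, d j * (Module.finrank ℝ (T.map (Bop E F B j)) : ℝ)

/-- The datum is simple if it has no critical subspace. -/
def Simple : Prop := ∀ T : Submodule ℝ (PiLp 2 E), ¬ IsCritical E F c d B T

end FRBL

namespace FRBL

/-- `log det` with value `−∞` on operators with non-positive determinant
(in particular on singular positive-semidefinite operators). -/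
def elogdet {G : Type*} [AddCommGroup G] [Module ℝ G] (A : G →ₗ[ℝ] G) : EReal :=
  if 0 < LinearMap.det A then ((Real.log (LinearMap.det A) : ℝ) : EReal) else ⊥

variable {k m : ℕ}
  (E : Fin k → Type*) (F : Fin m → Type*)
  [∀ i, NormedAddCommGroup (E i)] [∀ i, InnerProductSpace ℝ (E i)]
  [∀ i, FiniteDimensional ℝ (E i)]
  [∀ j, NormedAddCommGroup (F j)] [∀ j, InnerProductSpace ℝ (F j)]
  [∀ j, FiniteDimensional ℝ (F j)]
  (c : Fin k → ℝ) (d : Fin m → ℝ)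
  (B : ∀ i j, E i →ₗ[ℝ] F j)

/-- The map `Q_j := B_j Λ_c : E₀ → E^j`. -/
def BLam (j : Fin m) : PiLp 2 E →ₗ[ℝ] F j := (Bop E F B j).comp (Lam E c)

/-- The optimality condition of Theorem 2 (structure of gaussian extremizers):
each `B_j Λ_c Π Λ_c B_j*` is invertible and
`∑ⱼ dⱼ Λ_c B_j* (B_j Λ_c Π Λ_c B_j*)⁻¹ B_j Λ_c ≤ V_c` in the quadratic-form sense. -/
def ExtCond (V : ∀ i, E i →ₗ[ℝ] E i) (P : PiLp 2 E →ₗ[ℝ] PiLp 2 E) : Prop :=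
  (∀ j, IsUnit ((BLam E F c B j) ∘ₗ P ∘ₗ LinearMap.adjoint (BLam E F c B j))) ∧
  ∀ x : PiLp 2 E,
    (∑ j, d j * ⟪Ring.inverse ((BLam E F c B j) ∘ₗ P ∘ₗ LinearMap.adjoint (BLam E F c B j))
        (BLam E F c B j x), BLam E F c B j x⟫) ≤
      ∑ i, c i * ⟪V i (projL E i x), projL E i x⟫

/-- A geometric datum. -/
def Geometric : Prop :=
  ScalingCond E F c d ∧
  ∃ S ∈ Coupling E (fun i => (LinearMap.id : E i →ₗ[ℝ] E i)),
    (∀ j, (BLam E F c B j) ∘ₗ S ∘ₗ LinearMap.adjoint (BLam E F c B j) = LinearMap.id) ∧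
    ∀ x : PiLp 2 E, (∑ j, d j * ⟪BLam E F c B j x, BLam E F c B j x⟫) ≤ ⟪Lam E c x, x⟫

/-- Equivalence of data: `B'_j = C_j⁻¹ B_j C⁻¹` for invertible `C, C_j`. -/
def EquivData (B' : ∀ i j, E i →ₗ[ℝ] F j) : Prop :=
  ∃ (C : PiLp 2 E ≃ₗ[ℝ] PiLp 2 E) (Cj : ∀ j, F j ≃ₗ[ℝ] F j),
    ∀ j, Bop E F B' j =
      ((Cj j).symm.toLinearMap ∘ₗ Bop E F B j) ∘ₗ C.symm.toLinearMap

/-- `V_c = ⊕ᵢ cᵢ Vᵢ` as an operator on `E₀`. -/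
def blockDiag (V : ∀ i, E i →ₗ[ℝ] E i) : PiLp 2 E →ₗ[ℝ] PiLp 2 E :=
  ∑ i, c i • ((singleL E i) ∘ₗ (V i)) ∘ₗ (projL E i)

/-- `Θ = V_c − ∑ⱼ dⱼ Λ_c B_j* U_j B_j Λ_c`. -/
def Theta (V : ∀ i, E i →ₗ[ℝ] E i) (U : ∀ j, F j →ₗ[ℝ] F j) :
    PiLp 2 E →ₗ[ℝ] PiLp 2 E :=
  blockDiag E c V -
    ∑ j, d j • (LinearMap.adjoint (BLam E F c B j) ∘ₗ (U j)) ∘ₗ (BLam E F c B j)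

end FRBL

namespace FRBL

/-- Borel structure on submodules (inherited from the ambient space). -/
instance subBorel {G : Type*} [AddCommGroup G] [Module ℝ G] [TopologicalSpace G]
    [MeasurableSpace G] [BorelSpace G] (T : Submodule ℝ G) : BorelSpace ↥T :=
  Subtype.borelSpace (T : Set G)

/-- The maximal dimension of a subspace on which the self-adjoint operator `Q` is positive
definite; by Sylvester's law of inertia this is the number of positive eigenvalues of `Q`,
counted with multiplicity. -/
def posIndex {H : Type*} [NormedAddCommGroup H] [InnerProductSpace ℝ H]
    (Q : H →ₗ[ℝ] H) : ℕ :=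
  sSup {r : ℕ | ∃ W : Submodule ℝ H,
    (∀ x ∈ W, x ≠ 0 → 0 < ⟪Q x, x⟫) ∧ Module.finrank ℝ W = r}

/-- The standard gaussian probability measure on a Euclidean space. -/
def stdGaussian (G : Type*) [NormedAddCommGroup G] [InnerProductSpace ℝ G]
    [FiniteDimensional ℝ G] [MeasurableSpace G] [BorelSpace G] :
    Measure G :=
  volume.withDensity fun x =>
    ENNReal.ofReal ((2 * Real.pi) ^ (-(Module.finrank ℝ G : ℝ) / 2) *
      Real.exp (-‖x‖ ^ 2 / 2))

/-- `K_s = (|s|^{1/s} |s'|^{1/s'})^{1/2}`. -/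
def Kconst (s s' : ℝ) : ℝ := Real.sqrt (|s| ^ (1 / s) * |s'| ^ (1 / s'))

variable {k m : ℕ}
  (E : Fin k → Type*) (F : Fin m → Type*)
  [∀ i, NormedAddCommGroup (E i)] [∀ i, InnerProductSpace ℝ (E i)]
  [∀ i, FiniteDimensional ℝ (E i)]
  [∀ j, NormedAddCommGroup (F j)] [∀ j, InnerProductSpace ℝ (F j)]
  [∀ j, FiniteDimensional ℝ (F j)]
  (c : Fin k → ℝ) (d : Fin m → ℝ)
  (B : ∀ i j, E i →ₗ[ℝ] F j)

/-- The objective functional `∑ⱼ dⱼ log det Uⱼ − ∑ᵢ cᵢ log det Vᵢ`. -/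
def objective (V : ∀ i, E i →ₗ[ℝ] E i) (U : ∀ j, F j →ₗ[ℝ] F j) : ℝ :=
  ∑ j, d j * Real.log (LinearMap.det (U j)) - ∑ i, c i * Real.log (LinearMap.det (V i))

/-- Feasibility for the optimization problem defining `D_g`: positive definiteness
together with the constraint `Θ ≥ 0`. -/
def Admissible (V : ∀ i, E i →ₗ[ℝ] E i) (U : ∀ j, F j →ₗ[ℝ] F j) : Prop :=
  (∀ i, PosDef (V i)) ∧ (∀ j, PosDef (U j)) ∧ PosSemidef (Theta E F c d B V U)

/-- Global maximality in the optimization problem defining `D_g`. -/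
def IsGlobalMax (V : ∀ i, E i →ₗ[ℝ] E i) (U : ∀ j, F j →ₗ[ℝ] F j) : Prop :=
  Admissible E F c d B V U ∧
    ∀ V' U', Admissible E F c d B V' U' →
      objective E F c d V' U' ≤ objective E F c d V U

/-- Local maximality in the optimization problem defining `D_g`. -/
def IsLocalMax (V : ∀ i, E i →ₗ[ℝ] E i) (U : ∀ j, F j →ₗ[ℝ] F j) : Prop :=
  Admissible E F c d B V U ∧
    ∃ ε : ℝ, 0 < ε ∧
      ∀ V' U', Admissible E F c d B V' U' →
        (∀ i, ‖LinearMap.toContinuousLinearMap (V' i - V i)‖ < ε) →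
        (∀ j, ‖LinearMap.toContinuousLinearMap (U' j - U j)‖ < ε) →
        objective E F c d V' U' ≤ objective E F c d V U

end FRBL

namespace FRBL

section OneSpace

open InnerProductSpace

variable {G : Type*} [NormedAddCommGroup G] [InnerProductSpace ℝ G] [FiniteDimensional ℝ G]

/-- A linear functional on operators is represented, on symmetric operators, by a symmetric
operator through the trace pairing. -/
lemma exists_isSymmetric_trace_repr (g : (G →L[ℝ] G) →ₗ[ℝ] ℝ) :
    ∃ X : G →ₗ[ℝ] G, X.IsSymmetric ∧ (∀ v, ⟪X v, v⟫ = g (rankOne ℝ v v)) ∧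
      ∀ A : G →L[ℝ] G, (A : G →ₗ[ℝ] G).IsSymmetric →
        g A = LinearMap.trace ℝ G ((A : G →ₗ[ℝ] G) ∘ₗ X) := by
  let b : G → G → ℝ := fun v w => (g (rankOne ℝ v w) + g (rankOne ℝ w v)) / 2
  let ℓ : G → G →ₗ[ℝ] ℝ := fun v =>
    { toFun := b v
      map_add' := fun x y => by simp only [b, map_add, _root_.add_apply]; ring
      map_smul' := fun r x => by
        simp only [b, map_smul, _root_.smul_apply, smul_eq_mul, RingHom.id_apply]
        ring }
  let f : G → G := fun v => (toDual ℝ G).symm (LinearMap.toContinuousLinearMap (ℓ v))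
  have hf : ∀ v w, ⟪f v, w⟫ = b v w := fun v w => by
    simp only [f, toDual_symm_apply, LinearMap.coe_toContinuousLinearMap']
    rfl
  let X : G →ₗ[ℝ] G :=
    { toFun := f
      map_add' := fun x y => ext_inner_right ℝ fun w => by
        rw [inner_add_left, hf, hf, hf]
        simp only [b, map_add, _root_.add_apply]
        ring
      map_smul' := fun r x => ext_inner_right ℝ fun w => by
        rw [RingHom.id_apply, real_inner_smul_left, hf, hf]
        simp only [b, map_smul, _root_.smul_apply, smul_eq_mul]
        ring }
  have hX : ∀ v w, ⟪X v, w⟫ = b v w := hf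
  refine ⟨X, fun v w => ?_, fun v => ?_, fun A hA => ?_⟩
  · rw [hX, real_inner_comm, hX]
    simp only [b]
    ring
  · rw [hX]
    simp only [b]
    ring
  · let e := stdOrthonormalBasis ℝ G
    have h1 : A = ∑ a, rankOne ℝ (A (e a)) (e a) := by
      ext x
      simp only [_root_.sum_apply, rankOne_apply]
      conv_lhs => rw [← e.sum_repr' x]
      simp
    have h2 : A = ∑ a, rankOne ℝ (e a) (A (e a)) := by
      ext x
      simp only [_root_.sum_apply, rankOne_apply]
      conv_lhs => rw [← e.sum_repr' (A x)]
      exact Finset.sum_congr rfl fun a _ =>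
        congrArg (· • e a) (hA (e a) x).symm
    rw [LinearMap.trace_eq_sum_inner _ e]
    have h3 : ∀ a, ⟪e a, ((A : G →ₗ[ℝ] G) ∘ₗ X) (e a)⟫ = b (e a) (A (e a)) := fun a => by
      rw [LinearMap.comp_apply, ← hA, real_inner_comm, hX]
      rfl
    simp only [h3, b]
    rw [← Finset.sum_div, Finset.sum_add_distrib, ← map_sum, ← map_sum, ← h1, ← h2]
    ring

lemma PosDef.isUnit {A : G →ₗ[ℝ] G} (hA : PosDef A) : IsUnit A := by
  rw [LinearMap.isUnit_iff_ker_eq_bot, LinearMap.ker_eq_bot']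
  intro x hx
  by_contra h
  have := hA.2 x h
  simp [hx] at this

lemma PosDef.det_pos {A : G →ₗ[ℝ] G} (hA : PosDef A) : 0 < LinearMap.det A := by
  rw [hA.1.det_eq_prod_eigenvalues rfl]
  refine Finset.prod_pos fun a _ => ?_
  have h := hA.2 (hA.1.eigenvectorBasis rfl a) ((hA.1.eigenvectorBasis rfl).orthonormal.ne_zero a)
  rw [hA.1.apply_eigenvectorBasis, real_inner_smul_left, real_inner_self_eq_norm_sq] at h
  simpa using h

lemma PosDef.isSymmetric_inverse {A : G →ₗ[ℝ] G} (hA : PosDef A) :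
    (Ring.inverse A).IsSymmetric := by
  have h : ∀ x, A (Ring.inverse A x) = x := fun x =>
    LinearMap.congr_fun (Ring.mul_inverse_cancel A hA.isUnit) x
  intro x y
  conv_lhs => rw [← h y]
  conv_rhs => rw [← h x]
  exact (hA.1 _ _).symm

/-- Positive definiteness is stable under small symmetric perturbations. -/
lemma PosDef.eventually_add_smul {A X : G →ₗ[ℝ] G} (hA : PosDef A) (hX : X.IsSymmetric) :
    ∀ᶠ t : ℝ in nhds 0, PosDef (A + t • X) := by
  have hcont : Continuous fun z : ℝ × G => ⟪(A + z.1 • X) z.2, z.2⟫ := by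
    have h1 := A.continuous_of_finiteDimensional
    have h2 := X.continuous_of_finiteDimensional
    simp only [LinearMap.add_apply, LinearMap.smul_apply]
    fun_prop
  have hev : ∀ᶠ t : ℝ in nhds 0, ∀ x ∈ Metric.sphere (0 : G) 1, 0 < ⟪(A + t • X) x, x⟫ := by
    refine (isCompact_sphere (0 : G) 1).eventually_forall_of_forall_eventually fun x hx => ?_
    refine hcont.continuousAt.eventually (lt_mem_nhds ?_)
    simpa using hA.2 x (ne_zero_of_mem_unit_sphere ⟨x, hx⟩)
  filter_upwards [hev] with t ht
  refine ⟨hA.1.add (hX.smul (by simp)), fun x hx => ?_⟩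
  have hn : 0 < ‖x‖ := norm_pos_iff.2 hx
  have := ht (‖x‖⁻¹ • x) (by simp [norm_smul, hn.ne'])
  rw [map_smul, real_inner_smul_left, real_inner_smul_right] at this
  exact pos_of_mul_pos_right (pos_of_mul_pos_right this (by positivity)) (by positivity)

/-- First-order expansion of `log det` along a line. -/
lemma PosDef.hasDerivAt_log_det {A : G →ₗ[ℝ] G} (hA : PosDef A) (X : G →ₗ[ℝ] G) :
    HasDerivAt (fun t : ℝ => Real.log (LinearMap.det (A + t • X)))
      (LinearMap.trace ℝ G (Ring.inverse A ∘ₗ X)) 0 := by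
  let e := Module.finBasis ℝ G
  let M := LinearMap.toMatrix e e (Ring.inverse A ∘ₗ X)
  have hdet : ∀ t : ℝ, LinearMap.det (A + t • X) =
      LinearMap.det A * Matrix.det (1 + t • M) := fun t => by
    have h : A + t • X = A * (1 + t • (Ring.inverse A ∘ₗ X)) := by
      rw [mul_add, mul_one, mul_smul_comm, ← Module.End.mul_eq_comp, ← mul_assoc,
        Ring.mul_inverse_cancel A hA.isUnit, one_mul]
    rw [h, map_mul, ← LinearMap.det_toMatrix e (1 + _), map_add, map_smul, LinearMap.toMatrix_one]
  have hM : HasDerivAt (fun t : ℝ => Matrix.det (1 + t • M)) M.trace 0 := by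
    rw [funext fun t : ℝ => Matrix.det_one_add_smul t M]
    have h1 := ((hasDerivAt_id (0 : ℝ)).const_mul M.trace).const_add 1
    have h2 := ((Matrix.det (1 + (Polynomial.X : Polynomial ℝ) •
      M.map Polynomial.C)).divX.divX.hasDerivAt 0).mul (hasDerivAt_pow 2 (0 : ℝ))
    convert! h1.add h2 using 1
    simp
  have h := (hM.const_mul (LinearMap.det A)).log (by simp [hA.det_pos.ne'])
  simp only [← hdet] at h
  convert h using 1
  rw [LinearMap.trace_eq_matrix_trace ℝ e]
  simp [M, mul_div_cancel_left₀ _ hA.det_pos.ne']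

end OneSpace

end FRBL

namespace FRBL

section Moment

open InnerProductSpace

lemma posSemidef_rankOne {H : Type*} [NormedAddCommGroup H] [InnerProductSpace ℝ H] (x : H) :
    PosSemidef (rankOne ℝ x x : H →ₗ[ℝ] H) := by
  refine ⟨fun v w => ?_, fun v => ?_⟩
  · simp only [ContinuousLinearMap.coe_coe, rankOne_apply, real_inner_smul_left,
      real_inner_smul_right]
    rw [real_inner_comm x v]
    ring
  · simp only [ContinuousLinearMap.coe_coe, rankOne_apply, real_inner_smul_left]
    exact mul_self_nonneg _

lemma isClosed_posSemidef (H : Type*) [NormedAddCommGroup H] [InnerProductSpace ℝ H] :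
    IsClosed {P : H →L[ℝ] H | PosSemidef (P : H →ₗ[ℝ] H)} := by
  simp only [PosSemidef, LinearMap.IsSymmetric, Set.ofPred_and, Set.ofPred_forall]
  refine .inter (isClosed_iInter fun x => isClosed_iInter fun y => ?_)
    (isClosed_iInter fun x => ?_)
  · exact isClosed_eq (by simp only [ContinuousLinearMap.coe_coe]; fun_prop)
      (by simp only [ContinuousLinearMap.coe_coe]; fun_prop)
  · exact isClosed_le continuous_const (by simp only [ContinuousLinearMap.coe_coe]; fun_prop)

lemma convex_posSemidef (H : Type*) [NormedAddCommGroup H] [InnerProductSpace ℝ H] :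
    Convex ℝ {P : H →L[ℝ] H | PosSemidef (P : H →ₗ[ℝ] H)} := by
  intro P hP Q hQ a b ha hb _
  refine ⟨(hP.1.smul (by simp)).add (hQ.1.smul (by simp)), fun x => ?_⟩
  have h1 := hP.2 x
  have h2 := hQ.2 x
  simp only [ContinuousLinearMap.coe_coe, _root_.add_apply, _root_.smul_apply, inner_add_left,
    real_inner_smul_left] at h1 h2 ⊢
  positivity

variable {H ι κ : Type*} [Fintype ι] [Fintype κ] {E : ι → Type*} {F : κ → Type*}
  [NormedAddCommGroup H] [InnerProductSpace ℝ H] [FiniteDimensional ℝ H]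
  [∀ i, NormedAddCommGroup (E i)] [∀ i, InnerProductSpace ℝ (E i)]
  [∀ i, FiniteDimensional ℝ (E i)]
  [∀ j, NormedAddCommGroup (F j)] [∀ j, InnerProductSpace ℝ (F j)]
  [∀ j, FiniteDimensional ℝ (F j)]

/-- Conic duality: symmetric operators `A i`, `C j` are the compressions of a common positive
semidefinite operator as soon as they pair nonnegatively with every family of symmetric operators
whose pullback is positive semidefinite. -/
lemma exists_posSemidef_compressions (p : ∀ i, H →ₗ[ℝ] E i) (q : ∀ j, H →ₗ[ℝ] F j)
    (hp : ∀ x, ∑ i, ⟪p i x, p i x⟫ = ⟪x, x⟫)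
    (A : ∀ i, E i →ₗ[ℝ] E i) (C : ∀ j, F j →ₗ[ℝ] F j)
    (hA : ∀ i, (A i).IsSymmetric) (hC : ∀ j, (C j).IsSymmetric)
    (h : ∀ (X : ∀ i, E i →ₗ[ℝ] E i) (Y : ∀ j, F j →ₗ[ℝ] F j),
      (∀ i, (X i).IsSymmetric) → (∀ j, (Y j).IsSymmetric) →
      (∀ x, 0 ≤ ∑ i, ⟪X i (p i x), p i x⟫ + ∑ j, ⟪Y j (q j x), q j x⟫) →
      0 ≤ ∑ i, LinearMap.trace ℝ (E i) (A i ∘ₗ X i) +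
        ∑ j, LinearMap.trace ℝ (F j) (C j ∘ₗ Y j)) :
    ∃ P : H →ₗ[ℝ] H, PosSemidef P ∧ (∀ i, p i ∘ₗ P ∘ₗ LinearMap.adjoint (p i) = A i) ∧
      ∀ j, q j ∘ₗ P ∘ₗ LinearMap.adjoint (q j) = C j := by
  classical
  let p' : ∀ i, H →L[ℝ] E i := fun i => LinearMap.toContinuousLinearMap (p i)
  let q' : ∀ j, H →L[ℝ] F j := fun j => LinearMap.toContinuousLinearMap (q j)
  let A' : ∀ i, E i →L[ℝ] E i := fun i => LinearMap.toContinuousLinearMap (A i)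
  let C' : ∀ j, F j →L[ℝ] F j := fun j => LinearMap.toContinuousLinearMap (C j)
  let L : (H →L[ℝ] H) →ₗ[ℝ] (∀ i, E i →L[ℝ] E i) × (∀ j, F j →L[ℝ] F j) :=
    { toFun := fun P => (fun i => p' i ∘L P ∘L ContinuousLinearMap.adjoint (p' i),
        fun j => q' j ∘L P ∘L ContinuousLinearMap.adjoint (q' j))
      map_add' := fun P Q => by ext <;> simp
      map_smul' := fun r P => by ext <;> simp }
  have hLrank : ∀ x : H, L (rankOne ℝ x x) =
      (fun i => rankOne ℝ (p i x) (p i x), fun j => rankOne ℝ (q j x) (q j x)) := fun x => by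
    ext a v <;>
    simp [L, p', q', ContinuousLinearMap.adjoint_inner_right]
  let R : ℝ := |∑ i, LinearMap.trace ℝ (E i) (A i)| + 1
  have hR : 0 < R := by positivity
  let S : Set (H →L[ℝ] H) := (fun x => R • rankOne ℝ x x) '' Metric.closedBall (0 : H) 1
  have hS : IsCompact S := by
    refine (isCompact_closedBall (0 : H) 1).image ?_
    exact ((rankOne ℝ).continuous.clm_apply continuous_id).const_smul R
  let K : Set (H →L[ℝ] H) := closure (convexHull ℝ S)
  have hK : IsCompact K := TotallyBounded.isCompact_of_isClosed
    (TotallyBounded.closure (TotallyBounded.convexHull hS.totallyBounded)) isClosed_closure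
  have hKpos : K ⊆ {P : H →L[ℝ] H | PosSemidef (P : H →ₗ[ℝ] H)} := by
    refine closure_minimal (convexHull_min ?_ (convex_posSemidef H)) (isClosed_posSemidef H)
    rintro _ ⟨x, -, rfl⟩
    have := posSemidef_rankOne (√R • x)
    simpa [smul_smul, hR.le] using this
  by_cases hmem : ((A', C') : (∀ i, E i →L[ℝ] E i) × (∀ j, F j →L[ℝ] F j)) ∈ L '' K
  · obtain ⟨P, hPK, hP⟩ := hmem
    refine ⟨P, hKpos hPK, fun i => ?_, fun j => ?_⟩
    · ext v
      exact DFunLike.congr_fun (congrFun (congrArg Prod.fst hP) i) v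
    · ext v
      exact DFunLike.congr_fun (congrFun (congrArg Prod.snd hP) j) v
  exfalso
  have hKc : Convex ℝ (L '' K) := ((convex_convexHull ℝ S).closure).linear_image L
  have hKcl : IsClosed (L '' K) := (hK.image L.continuous_of_finiteDimensional).isClosed
  obtain ⟨f, s, hfT, hfK⟩ := geometric_hahn_banach_point_closed hKc hKcl hmem
  let g : ∀ i, (E i →L[ℝ] E i) →ₗ[ℝ] ℝ := fun i =>
    f.toLinearMap ∘ₗ LinearMap.inl ℝ _ _ ∘ₗ LinearMap.single ℝ (fun i => E i →L[ℝ] E i) i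
  let r : ∀ j, (F j →L[ℝ] F j) →ₗ[ℝ] ℝ := fun j =>
    f.toLinearMap ∘ₗ LinearMap.inr ℝ _ _ ∘ₗ LinearMap.single ℝ (fun j => F j →L[ℝ] F j) j
  have hf : ∀ a b, f (a, b) = ∑ i, g i (a i) + ∑ j, r j (b j) := fun a b => by
    have h1 : f (a, b) = f.toLinearMap (LinearMap.inl ℝ _ _ a) +
        f.toLinearMap (LinearMap.inr ℝ _ _ b) := by
      rw [← map_add]
      simp
    rw [h1]
    conv_lhs => rw [← LinearMap.sum_single_apply _ a, ← LinearMap.sum_single_apply _ b]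
    simp only [map_sum]
    rfl
  choose X hXs hXq hXt using fun i => exists_isSymmetric_trace_repr (g i)
  choose Y hYs hYq hYt using fun j => exists_isSymmetric_trace_repr (r j)
  have hball : ∀ x : H, ‖x‖ ≤ 1 →
      s < R * (∑ i, ⟪X i (p i x), p i x⟫ + ∑ j, ⟪Y j (q j x), q j x⟫) := fun x hx => by
    have hxK : R • rankOne ℝ x x ∈ K :=
      subset_closure (subset_convexHull ℝ S ⟨x, by simpa using hx, rfl⟩)
    have := hfK _ (Set.mem_image_of_mem L hxK)
    rw [map_smul, map_smul, hLrank, hf, smul_eq_mul] at this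
    simpa only [hXq, hYq] using this
  have hs : s < 0 := by simpa using hball 0 (by simp)
  have hT : f (A', C') = ∑ i, LinearMap.trace ℝ (E i) (A i ∘ₗ X i) +
      ∑ j, LinearMap.trace ℝ (F j) (C j ∘ₗ Y j) := by
    rw [hf]
    congr 1
    · exact Finset.sum_congr rfl fun i _ => hXt i (A' i) (hA i)
    · exact Finset.sum_congr rfl fun j _ => hYt j (C' j) (hC j)
  have key := h (fun i => X i + (-s / R) • LinearMap.id) Y
    (fun i => (hXs i).add (LinearMap.IsSymmetric.id.smul (by simp))) hYs fun x => by
      simp only [LinearMap.add_apply, LinearMap.smul_apply, LinearMap.id_apply, inner_add_left,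
        real_inner_smul_left, Finset.sum_add_distrib, ← Finset.mul_sum, hp]
      obtain rfl | hx := eq_or_ne x 0
      · simp
      have hn : 0 < ‖x‖ := norm_pos_iff.2 hx
      have hb := hball (‖x‖⁻¹ • x) (by simp [norm_smul, hn.ne'])
      simp only [map_smul, real_inner_smul_left, real_inner_smul_right, ← mul_assoc,
        ← Finset.mul_sum, ← mul_add] at hb
      rw [real_inner_self_eq_norm_sq]
      have : s / R * ‖x‖ ^ 2 <
          ∑ i, ⟪X i (p i x), p i x⟫ + ∑ j, ⟪Y j (q j x), q j x⟫ := by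
        rw [div_mul_eq_mul_div, div_lt_iff₀ hR]
        calc s * ‖x‖ ^ 2 < _ := mul_lt_mul_of_pos_right hb (by positivity)
          _ = _ := by field_simp
      rw [neg_div, neg_mul]
      linarith
  simp only [LinearMap.comp_add, LinearMap.comp_smul, LinearMap.comp_id, map_add, map_smul,
    Finset.sum_add_distrib, smul_eq_mul, ← Finset.mul_sum] at key
  rw [hT] at hfT
  have hle : -s / R * ∑ i, LinearMap.trace ℝ (E i) (A i) ≤ -s := by
    rw [div_mul_eq_mul_div, div_le_iff₀ hR]
    refine mul_le_mul_of_nonneg_left ?_ (by linarith)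
    exact (le_abs_self _).trans (by simp [R])
  linarith

end Moment

end FRBL

namespace FRBL

section Variation

variable {k m : ℕ}
  {E : Fin k → Type*} {F : Fin m → Type*}
  [∀ i, NormedAddCommGroup (E i)] [∀ i, InnerProductSpace ℝ (E i)]
  [∀ j, NormedAddCommGroup (F j)] [∀ j, InnerProductSpace ℝ (F j)]
  {c : Fin k → ℝ} {d : Fin m → ℝ}
  {B : ∀ i j, E i →ₗ[ℝ] F j}

lemma GaussCon.smul {V : ∀ i, E i →ₗ[ℝ] E i} {U : ∀ j, F j →ₗ[ℝ] F j}
    (h : GaussCon E F c d B V U) {r : ℝ} (hr : 0 ≤ r) :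
    GaussCon E F c d B (fun i => r • V i) (fun j => r • U j) := by
  intro x
  simp only [LinearMap.smul_apply, real_inner_smul_left, mul_left_comm _ r, ← Finset.mul_sum]
  exact mul_le_mul_of_nonneg_left (h x) hr

@[simp] lemma projL_apply (i : Fin k) (x : PiLp 2 E) : projL E i x = x i := rfl

lemma BLam_apply (j : Fin m) (x : PiLp 2 E) : BLam E F c B j x = ∑ i, c i • B i j (x i) := by
  have h : ∀ i, Lam E c x i = c i • x i := fun i => by
    have h' : projL E i (Lam E c x) = c i • x i := by
      simp only [Lam, LinearMap.sum_apply, map_sum]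
      rw [Finset.sum_eq_single i]
      · simp [singleL, toPi]
      · intro l _ hl
        simp [singleL, toPi, hl.symm]
      · simp
    exact h'
  simp [BLam, Bop, h]

variable [∀ i, FiniteDimensional ℝ (E i)] [∀ j, FiniteDimensional ℝ (F j)]

/-- First-order necessary condition at a maximizer of the gaussian objective. -/
lemma trace_le_trace_of_isMax
    {V X : ∀ i, E i →ₗ[ℝ] E i} {U Y : ∀ j, F j →ₗ[ℝ] F j}
    (hV : ∀ i, PosDef (V i)) (hU : ∀ j, PosDef (U j))
    (hmax : ∀ V' U', (∀ i, PosDef (V' i)) → (∀ j, PosDef (U' j)) → GaussCon E F c d B V' U' →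
      gaussObj E F c d V' U' ≤ gaussObj E F c d V U)
    (hX : ∀ i, (X i).IsSymmetric) (hY : ∀ j, (Y j).IsSymmetric)
    (hcon : ∀ᶠ t : ℝ in nhdsWithin 0 (Set.Ioi 0),
      GaussCon E F c d B (fun i => V i + t • X i) (fun j => U j + t • Y j)) :
    ∑ j, d j * LinearMap.trace ℝ (F j) (Ring.inverse (U j) ∘ₗ Y j) ≤
      ∑ i, c i * LinearMap.trace ℝ (E i) (Ring.inverse (V i) ∘ₗ X i) := by
  have hder : HasDerivAt
      (fun t : ℝ => gaussObj E F c d (fun i => V i + t • X i) (fun j => U j + t • Y j))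
      ((∑ j, d j * LinearMap.trace ℝ (F j) (Ring.inverse (U j) ∘ₗ Y j) -
        ∑ i, c i * LinearMap.trace ℝ (E i) (Ring.inverse (V i) ∘ₗ X i)) / 2) 0 :=
    ((HasDerivAt.fun_sum fun j _ => ((hU j).hasDerivAt_log_det (Y j)).const_mul (d j)).sub
      (HasDerivAt.fun_sum fun i _ =>
        ((hV i).hasDerivAt_log_det (X i)).const_mul (c i))).div_const 2
  have hslope := (hasDerivWithinAt_iff_tendsto_slope' (by simp)).1
    (hder.hasDerivWithinAt (s := Set.Ioi 0))
  have hVt : ∀ᶠ t : ℝ in nhds 0, ∀ i, PosDef (V i + t • X i) :=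
    Filter.eventually_all.2 fun i => (hV i).eventually_add_smul (hX i)
  have hUt : ∀ᶠ t : ℝ in nhds 0, ∀ j, PosDef (U j + t • Y j) :=
    Filter.eventually_all.2 fun j => (hU j).eventually_add_smul (hY j)
  have hnonpos := le_of_tendsto hslope (b := 0) (by
    filter_upwards [hcon, hVt.filter_mono nhdsWithin_le_nhds, hUt.filter_mono nhdsWithin_le_nhds,
      self_mem_nhdsWithin] with t h1 h2 h3 h4
    rw [slope_def_field, sub_zero]
    refine div_nonpos_of_nonpos_of_nonneg (sub_nonpos.2 ?_) (le_of_lt h4)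
    simpa using hmax _ _ h2 h3 h1)
  linarith

/-- Homogeneity of the constraint forces the scaling condition at a maximizer. -/
lemma scalingCond_of_isMax
    {V : ∀ i, E i →ₗ[ℝ] E i} {U : ∀ j, F j →ₗ[ℝ] F j}
    (hV : ∀ i, PosDef (V i)) (hU : ∀ j, PosDef (U j)) (hVU : GaussCon E F c d B V U)
    (hmax : ∀ V' U', (∀ i, PosDef (V' i)) → (∀ j, PosDef (U' j)) → GaussCon E F c d B V' U' →
      gaussObj E F c d V' U' ≤ gaussObj E F c d V U) :
    ScalingCond E F c d := by
  have hscale : ∀ a : ℝ, a * ∑ j, d j * (Module.finrank ℝ (F j) : ℝ) ≤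
      a * ∑ i, c i * (Module.finrank ℝ (E i) : ℝ) := fun a => by
    have hpos : ∀ᶠ t : ℝ in nhdsWithin 0 (Set.Ioi 0), 0 < 1 + t * a := by
      have hc : Continuous fun t : ℝ => 1 + t * a := by fun_prop
      exact (hc.continuousAt.eventually (lt_mem_nhds (by simp))).filter_mono nhdsWithin_le_nhds
    have h := trace_le_trace_of_isMax (X := fun i => a • V i) (Y := fun j => a • U j)
      hV hU hmax (fun i => (hV i).1.smul (by simp)) (fun j => (hU j).1.smul (by simp)) (by
        filter_upwards [hpos] with t ht
        simpa only [add_smul, one_smul, mul_smul] using hVU.smul ht.le)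
    have hVi : ∀ i, Ring.inverse (V i) ∘ₗ V i = LinearMap.id := fun i =>
      Ring.inverse_mul_cancel _ (hV i).isUnit
    have hUj : ∀ j, Ring.inverse (U j) ∘ₗ U j = LinearMap.id := fun j =>
      Ring.inverse_mul_cancel _ (hU j).isUnit
    simpa only [LinearMap.comp_smul, hVi, hUj, map_smul, LinearMap.trace_id, smul_eq_mul,
      mul_left_comm _ a, ← Finset.mul_sum] using h
  have h1 := hscale 1
  have h2 := hscale (-1)
  exact le_antisymm (by linarith) (by linarith)

lemma adjoint_projL (i : Fin k) : LinearMap.adjoint (projL E i) = singleL E i := by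
  symm
  rw [LinearMap.eq_adjoint_iff]
  intro v x
  simp only [PiLp.inner_apply, projL_apply]
  rw [Finset.sum_eq_single i]
  · simp [singleL, toPi]
  · intro j _ hj
    simp [singleL, toPi, hj]
  · simp

/-- At a maximizer, `V⁻¹` and `U⁻¹` are the compressions of a common coupling. -/
lemma exists_coupling_of_isMax (hc : ∀ i, 0 < c i) (hd : ∀ j, 0 < d j)
    {V : ∀ i, E i →ₗ[ℝ] E i} {U : ∀ j, F j →ₗ[ℝ] F j}
    (hV : ∀ i, PosDef (V i)) (hU : ∀ j, PosDef (U j)) (hVU : GaussCon E F c d B V U)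
    (hmax : ∀ V' U', (∀ i, PosDef (V' i)) → (∀ j, PosDef (U' j)) → GaussCon E F c d B V' U' →
      gaussObj E F c d V' U' ≤ gaussObj E F c d V U) :
    ∃ P ∈ Coupling E (fun i => Ring.inverse (V i)),
      ∀ j, BLam E F c B j ∘ₗ P ∘ₗ LinearMap.adjoint (BLam E F c B j) = Ring.inverse (U j) := by
  obtain ⟨P, hP, hPV, hPU⟩ := exists_posSemidef_compressions (projL E) (BLam E F c B)
    (fun x => (PiLp.inner_apply x x).symm)
    (fun i => Ring.inverse (V i)) (fun j => Ring.inverse (U j))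
    (fun i => (hV i).isSymmetric_inverse) (fun j => (hU j).isSymmetric_inverse)
    fun X Y hX hY hXY => by
      have h := trace_le_trace_of_isMax (X := fun i => (c i)⁻¹ • X i)
        (Y := fun j => -(d j)⁻¹ • Y j) hV hU hmax
        (fun i => (hX i).smul (by simp)) (fun j => (hY j).smul (by simp)) (by
          filter_upwards [self_mem_nhdsWithin] with t ht x
          have h1 := mul_le_mul_of_nonneg_left (hXY (WithLp.toLp 2 x)) (le_of_lt ht)
          have h2 := hVU x
          simp only [BLam_apply, projL_apply] at h1
          simp only [LinearMap.add_apply, LinearMap.smul_apply,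
            inner_add_left, real_inner_smul_left, mul_add, neg_mul, mul_neg,
            Finset.sum_add_distrib, Finset.sum_neg_distrib, mul_left_comm _ t,
            mul_inv_cancel_left₀ (hc _).ne', mul_inv_cancel_left₀ (hd _).ne', ← Finset.mul_sum]
          rw [mul_zero, mul_add] at h1
          linarith)
      simp only [LinearMap.comp_smul, map_smul, smul_eq_mul, neg_mul, mul_neg,
        Finset.sum_neg_distrib, mul_inv_cancel_left₀ (hc _).ne',
        mul_inv_cancel_left₀ (hd _).ne'] at h
      linarith
  refine ⟨P, ⟨hP, fun i v => ?_⟩, hPU⟩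
  simp only [← hPV i, ← adjoint_projL, LinearMap.comp_apply, LinearMap.adjoint_inner_right]

end Variation

end FRBL

namespace FRBL

variable {k m : ℕ}
  (E : Fin k → Type*) (F : Fin m → Type*)
  [∀ i, NormedAddCommGroup (E i)] [∀ i, InnerProductSpace ℝ (E i)]
  [∀ i, FiniteDimensional ℝ (E i)]
  [∀ i, MeasurableSpace (E i)] [∀ i, BorelSpace (E i)]
  [∀ j, NormedAddCommGroup (F j)] [∀ j, InnerProductSpace ℝ (F j)]
  [∀ j, FiniteDimensional ℝ (F j)]
  [∀ j, MeasurableSpace (F j)] [∀ j, BorelSpace (F j)]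

/-- **Proposition (necessary optimality conditions).** If a datum `(c,d,B)` is
gaussian-extremizable, then the scaling condition holds and there exist positive-definite
`Vᵢ` on `Eᵢ` and `Π ∈ Π(V₁⁻¹,…,V_k⁻¹)` such that each `B_j Λ_c Π Λ_c B_j*` is invertible
and `∑ⱼ dⱼ Λ_c B_j* (B_j Λ_c Π Λ_c B_j*)⁻¹ B_j Λ_c ≤ ⊕ᵢ cᵢ Vᵢ`. -/
theorem gaussExt_optimality
    (c : Fin k → ℝ) (d : Fin m → ℝ) (B : ∀ i j, E i →ₗ[ℝ] F j)
    (hc : ∀ i, 0 < c i) (hd : ∀ j, 0 < d j)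
    (hext : GaussExt E F c d B) :
    ScalingCond E F c d ∧
    ∃ (V : ∀ i, E i →ₗ[ℝ] E i) (P : PiLp 2 E →ₗ[ℝ] PiLp 2 E),
      (∀ i, PosDef (V i)) ∧
      P ∈ Coupling E (fun i => Ring.inverse (V i)) ∧
      ExtCond E F c d B V P := by
  obtain ⟨V, U, hV, hU, hVU, hDg⟩ := hext
  have hmax : ∀ V' U', (∀ i, PosDef (V' i)) → (∀ j, PosDef (U' j)) → GaussCon E F c d B V' U' →
      gaussObj E F c d V' U' ≤ gaussObj E F c d V U := fun V' U' hV' hU' hVU' => by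
    rw [← EReal.coe_le_coe_iff, ← hDg]
    exact le_sSup ⟨V', U', hV', hU', hVU', rfl⟩
  refine ⟨scalingCond_of_isMax hV hU hVU hmax, V, ?_⟩
  obtain ⟨P, hP, hPU⟩ := exists_coupling_of_isMax hc hd hV hU hVU hmax
  refine ⟨P, hV, hP, fun j => ?_, fun x => ?_⟩
  · rw [hPU]
    exact (hU j).isUnit.ringInverse
  · simp only [hPU, Ring.inverse_inverse (hU _).isUnit, BLam_apply, projL_apply]
    exact hVU fun i => x i

end FRBL
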